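/- Let K be a field, G a finite group, and H a finite abelian group of exponent e. Assume K contains a primitive e-th root of unity and that K(G) is rational over K. Then K(H × G) is rational over K. -/

import Mathlib

set_option synthInstance.maxHeartbeats 1000000
set_option maxHeartbeats 1000000

noncomputable section

/-- The rational function field `K(x(g) : g ∈ G)` in variables indexed by `G`. -/
abbrev NoetherBigField (K : Type*) [Field K] (G : Type*) : Type _ :=
  FractionRing (MvPolynomial G K)

/-- The `K`-automorphism of `K(x(g) : g ∈ G)` induced by `h · x(g) = x(hg)`. -/
def noetherAut (K : Type*) [Field K] (G : Type*) [Group G] (h : G) :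
    NoetherBigField K G ≃ₐ[K] NoetherBigField K G :=
  IsFractionRing.algEquivOfAlgEquiv (MvPolynomial.renameEquiv K (Equiv.mulLeft h))

/-- The fixed field `K(G) = K(x(g) : g ∈ G)^G`, as a subfield. -/
def noetherSubfield (K : Type*) [Field K] (G : Type*) [Group G] :
    Subfield (NoetherBigField K G) where
  carrier := {x | ∀ h : G, noetherAut K G h x = x}
  mul_mem' := by intro a b ha hb h; rw [map_mul, ha h, hb h]
  one_mem' := by intro h; rw [map_one]
  add_mem' := by intro a b ha hb h; rw [map_add, ha h, hb h]
  zero_mem' := by intro h; rw [map_zero]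
  neg_mem' := by intro a ha h; rw [map_neg, ha h]
  inv_mem' := by intro a ha h; rw [map_inv₀, ha h]

/-- Noether's fixed field `K(G) = K(x(g) : g ∈ G)^G`. -/
def NoetherField (K : Type*) [Field K] (G : Type*) [Group G] : Type _ :=
  noetherSubfield K G

instance (K : Type*) [Field K] (G : Type*) [Group G] : Field (NoetherField K G) :=
  inferInstanceAs (Field (noetherSubfield K G))

theorem algebraMap_mem_noetherSubfield (K : Type*) [Field K] (G : Type*) [Group G] (c : K) :
    algebraMap K (NoetherBigField K G) c ∈ noetherSubfield K G := by
  intro h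
  exact AlgEquiv.commutes _ c

instance (K : Type*) [Field K] (G : Type*) [Group G] : Algebra K (NoetherField K G) :=
  RingHom.toAlgebra <|
    ((algebraMap K (NoetherBigField K G)).codRestrict (noetherSubfield K G).toSubring
      (algebraMap_mem_noetherSubfield K G))

/-- An extension `L/F` is rational (purely transcendental) if `L` is `F`-isomorphic to a
rational function field `F(t₁, …, tₙ)` over `F` in finitely many variables. -/
def IsRationalExtension (F L : Type*) [Field F] [Field L] [Algebra F L] : Prop :=
  ∃ n : ℕ, Nonempty (L ≃ₐ[F] FractionRing (MvPolynomial (Fin n) F))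

/-- An extension `L/F` is stably rational if the rational function field `L(y₁, …, y_r)`
is rational over `F` for some finite number `r` of indeterminates. -/
def IsStablyRationalExtension (F L : Type*) [Field F] [Field L] [Algebra F L] : Prop :=
  ∃ r : ℕ, IsRationalExtension F (FractionRing (MvPolynomial (Fin r) L))

def nX (K : Type*) [Field K] {G : Type*} (g : G) : NoetherBigField K G :=
  algebraMap (MvPolynomial G K) _ (MvPolynomial.X g)

theorem noetherAut_nX (K : Type*) [Field K] {G : Type*} [Group G] (h g : G) :
    noetherAut K G h (nX K g) = nX K (h * g) := by
  simp [noetherAut, nX]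

theorem nX_injective (K : Type*) [Field K] (G : Type*) :
    Function.Injective (nX K : G → NoetherBigField K G) := by
  intro a b h
  exact MvPolynomial.X_injective (IsFractionRing.injective (MvPolynomial G K) _ h)

theorem big_hom_ext (K : Type*) [Field K] {G : Type*} {E : Type*} [Field E] [Algebra K E]
    {f g : NoetherBigField K G →ₐ[K] E} (h : ∀ i, f (nX K i) = g (nX K i)) : f = g := by
  apply IsLocalization.algHom_ext (nonZeroDivisors (MvPolynomial G K))
  ext i
  exact h i

@[reducible] def noetherAction (K : Type*) [Field K] (G : Type*) [Group G] :
    MulSemiringAction G (NoetherBigField K G) where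
  smul h x := noetherAut K G h x
  one_smul x := by
    change noetherAut K G 1 x = x
    have : (noetherAut K G 1).toAlgHom = AlgHom.id K _ := by
      apply big_hom_ext
      intro i
      simp [noetherAut_nX, mul_assoc]
    exact DFunLike.congr_fun this x
  mul_smul a b x := by
    change noetherAut K G (a * b) x = noetherAut K G a (noetherAut K G b x)
    have : (noetherAut K G (a * b)).toAlgHom =
        (noetherAut K G a).toAlgHom.comp (noetherAut K G b).toAlgHom := by
      apply big_hom_ext
      intro i
      simp [noetherAut_nX, mul_assoc]
    exact DFunLike.congr_fun this x
  smul_zero h := map_zero (noetherAut K G h)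
  smul_add h := map_add (noetherAut K G h)
  smul_one h := map_one (noetherAut K G h)
  smul_mul h := map_mul (noetherAut K G h)

theorem noether_faithful (K : Type*) [Field K] (G : Type*) [Group G] :
    letI := noetherAction K G
    FaithfulSMul G (NoetherBigField K G) := by
  let := noetherAction K G
  constructor
  intro a b h
  have := h (nX K 1)
  change noetherAut K G a _ = noetherAut K G b _ at this
  rw [noetherAut_nX, noetherAut_nX] at this
  simpa using nX_injective K G this

theorem noether_finrank (K : Type*) [Field K] (G : Type*) [Group G] [Finite G] :
    Module.finrank (noetherSubfield K G) (NoetherBigField K G) = Nat.card G := by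
  let := noetherAction K G
  have := noether_faithful K G
  have := Fintype.ofFinite G
  rw [Nat.card_eq_fintype_card]
  exact FixedPoints.finrank_eq_card G (NoetherBigField K G)

theorem noether_findim (K : Type*) [Field K] (G : Type*) [Group G] [Finite G] :
    FiniteDimensional (noetherSubfield K G) (NoetherBigField K G) := by
  let := noetherAction K G
  exact inferInstanceAs (FiniteDimensional (FixedPoints.subfield G (NoetherBigField K G)) _)

theorem noether_adjoin (K : Type*) [Field K] (G : Type*) [Group G] [Finite G] :
    IntermediateField.adjoin (noetherSubfield K G) {nX K (1 : G)} = ⊤ := by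
  let := noetherAction K G
  have := noether_faithful K G
  have := noether_findim K G
  have : IsGalois (noetherSubfield K G) (NoetherBigField K G) :=
    inferInstanceAs (IsGalois (FixedPoints.subfield G (NoetherBigField K G)) _)
  rw [← IsGalois.fixedField_fixingSubgroup
    (IntermediateField.adjoin (noetherSubfield K G) {nX K (1 : G)})]
  have : (IntermediateField.adjoin (noetherSubfield K G) {nX K (1 : G)}).fixingSubgroup = ⊥ := by
    rw [eq_bot_iff]
    intro σ hσ
    obtain ⟨g, hg⟩ := FixedPoints.toAlgAut_surjective G (NoetherBigField K G) σ
    have h1 := (IntermediateField.mem_fixingSubgroup_iff _ σ).1 hσ (nX K 1)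
      (IntermediateField.mem_adjoin_simple_self _ _)
    have h2 : noetherAut K G g (nX K 1) = nX K 1 := by
      rw [← hg] at h1
      exact h1
    rw [noetherAut_nX] at h2
    have h3 : g = 1 := by simpa using nX_injective K G h2
    rw [Subgroup.mem_bot, ← hg, h3, map_one]
    rfl
  rw [this, IntermediateField.fixedField_bot]

def noetherIF (K : Type*) [Field K] (G : Type*) [Group G] :
    IntermediateField K (NoetherBigField K G) :=
  (noetherSubfield K G).toIntermediateField (algebraMap_mem_noetherSubfield K G)

def noetherFieldEquiv (K : Type*) [Field K] (G : Type*) [Group G] :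
    NoetherField K G ≃ₐ[K] noetherIF K G :=
  { (RingEquiv.refl (noetherSubfield K G) : NoetherField K G ≃+* noetherIF K G) with
    commutes' := fun _ => rfl }

theorem noetherIF_finrank (K : Type*) [Field K] (G : Type*) [Group G] [Finite G] :
    Module.finrank (noetherIF K G) (NoetherBigField K G) = Nat.card G :=
  noether_finrank K G

theorem noetherIF_findim (K : Type*) [Field K] (G : Type*) [Group G] [Finite G] :
    FiniteDimensional (noetherIF K G) (NoetherBigField K G) :=
  noether_findim K G

theorem big_basis (K : Type*) [Field K] (G : Type*) :
    IsTranscendenceBasis K (nX K : G → NoetherBigField K G) := by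
  have : Algebra.IsAlgebraic (MvPolynomial G K) (NoetherBigField K G) :=
    IsLocalization.isAlgebraic _ (nonZeroDivisors (MvPolynomial G K))
  exact (IsTranscendenceBasis.mvPolynomial G K).algebraMap_comp (A := NoetherBigField K G)

theorem big_trdeg (K : Type*) [Field K] (G : Type*) [Finite G] :
    Algebra.trdeg K (NoetherBigField K G) = Nat.card G := by
  have := (big_basis K G).lift_cardinalMk_eq_trdeg
  rw [← Nat.cast_card] at this
  simpa using this.symm

theorem noetherIF_trdeg (K : Type*) [Field K] (G : Type*) [Group G] [Finite G] :
    Algebra.trdeg K (noetherIF K G) = Nat.card G := by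
  have := noetherIF_findim K G
  have h := trdeg_add_eq K (noetherIF K G) (A := NoetherBigField K G)
  rw [trdeg_eq_zero (R := noetherIF K G), add_zero, big_trdeg] at h
  exact h

theorem adjoin_nX (K : Type*) [Field K] (G : Type*) :
    IntermediateField.adjoin K (Set.range (nX K : G → NoetherBigField K G)) = ⊤ := by
  rw [eq_top_iff]
  intro x _
  obtain ⟨a, b, hb, rfl⟩ := IsFractionRing.div_surjective (A := MvPolynomial G K) x
  have key : ∀ p : MvPolynomial G K, algebraMap _ (NoetherBigField K G) p ∈
      IntermediateField.adjoin K (Set.range (nX K : G → NoetherBigField K G)) := by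
    intro p
    induction p using MvPolynomial.induction_on with
    | C a => exact IntermediateField.algebraMap_mem _ a
    | add p q hp hq => rw [map_add]; exact add_mem hp hq
    | mul_X p i hp => 
      rw [map_mul]
      exact mul_mem hp (IntermediateField.subset_adjoin _ _ ⟨i, rfl⟩)
  exact div_mem (key a) (key b)

/-- rationality of a field extension via generators -/
theorem rational_of_gen (K F : Type*) [Field K] [Field F] [Algebra K F] {ι : Type*} [Finite ι]
    (h : Algebra.trdeg K F = Nat.card ι) (u : ι → F)
    (hu : IntermediateField.adjoin K (Set.range u) = ⊤) : IsRationalExtension K F := by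
  have : Algebra.IsAlgebraic (Algebra.adjoin K (Set.range u)) F := by
    have : Algebra.IsAlgebraic (IntermediateField.adjoin K (Set.range u)) F := by
      rw [hu]
      constructor
      intro x
      exact isAlgebraic_algebraMap (⟨x, trivial⟩ : (⊤ : IntermediateField K F))
    open scoped IntermediateField.algebraAdjoinAdjoin in
    exact (IsFractionRing.comap_isAlgebraic_iff (K := IntermediateField.adjoin K (Set.range u))).2
      this
  have hb := Algebra.IsAlgebraic.isTranscendenceBasis_of_lift_le_trdeg_of_finite K u (by
    rw [h, ← Nat.cast_card]; simp)
  let e1 := hb.1.aevalEquivField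
  let e2 : FractionRing (MvPolynomial ι K) ≃ₐ[K] FractionRing (MvPolynomial (Fin (Nat.card ι)) K) :=
    IsFractionRing.algEquivOfAlgEquiv (MvPolynomial.renameEquiv K (Finite.equivFin ι))
  exact ⟨Nat.card ι, ⟨(IntermediateField.topEquiv.symm.trans
    (IntermediateField.equivOfEq hu.symm)).trans (e1.symm.trans e2)⟩⟩

theorem rational_iff_gen (K : Type*) [Field K] (G : Type*) [Group G] [Finite G] :
    IsRationalExtension K (NoetherField K G) ↔ ∃ t : Fin (Nat.card G) → NoetherBigField K G,
      IntermediateField.adjoin K (Set.range t) = noetherIF K G := by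
  constructor
  · rintro ⟨n, ⟨e⟩⟩
    let e' := (e.symm.trans (noetherFieldEquiv K G))
    have hn : n = Nat.card G := by
      have h1 := e'.lift_trdeg_eq
      rw [noetherIF_trdeg] at h1
      rw [big_trdeg K (Fin n)] at h1
      simpa using h1
    subst hn
    refine ⟨fun i => (e' (nX K i) : NoetherBigField K G), ?_⟩
    have h2 := congrArg (IntermediateField.map ((noetherIF K G).val.comp (e' : _ →ₐ[K] _)))
      (adjoin_nX K (Fin (Nat.card G)))
    rw [IntermediateField.adjoin_map, ← Set.range_comp] at h2
    refine Eq.trans h2 ?_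
    rw [← AlgHom.fieldRange_eq_map]
    ext x
    simp only [AlgHom.mem_fieldRange]
    constructor
    · rintro ⟨y, rfl⟩
      exact (e' y).2
    · intro hx
      exact ⟨e'.symm ⟨x, hx⟩, by simp⟩
  · rintro ⟨t, ht⟩
    have htm : ∀ i, t i ∈ noetherIF K G := fun i => by
      rw [← ht]; exact IntermediateField.subset_adjoin _ _ ⟨i, rfl⟩
    obtain ⟨n, ⟨e⟩⟩ := rational_of_gen K (noetherIF K G) (ι := Fin (Nat.card G))
      (by rw [noetherIF_trdeg]; simp) (fun i => ⟨t i, htm i⟩) (by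
        apply IntermediateField.map_injective (noetherIF K G).val
        rw [IntermediateField.adjoin_map, ← Set.range_comp, ← AlgHom.fieldRange_eq_map,
          IntermediateField.fieldRange_val]
        exact ht)
    exact ⟨n, ⟨(noetherFieldEquiv K G).trans e⟩⟩

theorem vand {E : Type*} [Field E] (S : Subfield E) {ι : Type*} [Fintype ι] (v x : ι → E)
    (hv : Function.Injective v) (hvS : ∀ i, v i ∈ S)
    (h : ∀ j < Fintype.card ι, ∑ i, v i ^ j * x i ∈ S) (i : ι) : x i ∈ S := by
  classical
  let v' : ι → S := fun i => ⟨v i, hvS i⟩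
  have hv' : Function.Injective v' := fun a b hab => hv (congrArg Subtype.val hab)
  let p : Polynomial S := Lagrange.basis Finset.univ v' i
  have hdeg : p.natDegree < Fintype.card ι := by
    have h1 : p.degree = _ := Lagrange.degree_basis (s := Finset.univ) (v := v')
      hv'.injOn (Finset.mem_univ i)
    have h2 := Polynomial.natDegree_eq_of_degree_eq_some h1
    have : 0 < Fintype.card ι := Fintype.card_pos_iff.2 ⟨i⟩
    rw [h2, Finset.card_univ]
    omega
  have hev : ∀ l, Polynomial.aeval (v l) p = if l = i then (1 : E) else 0 := by
    intro l
    have : v l = algebraMap S E (v' l) := rfl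
    rw [this, Polynomial.aeval_algebraMap_apply, Polynomial.coe_aeval_eq_eval]
    split_ifs with hl
    · subst hl
      rw [Lagrange.eval_basis_self hv'.injOn (Finset.mem_univ _), map_one]
    · rw [Lagrange.eval_basis_of_ne (fun h => hl h.symm) (Finset.mem_univ _), map_zero]
  have hx : x i = ∑ l, Polynomial.aeval (v l) p * x l := by
    simp [hev]
  rw [hx]
  have : ∑ l, Polynomial.aeval (v l) p * x l =
      ∑ j ∈ Finset.range (Fintype.card ι), (p.coeff j : E) * ∑ l, v l ^ j * x l := by
    simp_rw [Finset.mul_sum]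
    rw [Finset.sum_comm]
    refine Finset.sum_congr rfl fun l _ => ?_
    rw [Polynomial.aeval_eq_sum_range' hdeg, Finset.sum_mul]
    refine Finset.sum_congr rfl fun j _ => ?_
    rw [Algebra.smul_def, mul_assoc]
    rfl
  rw [this]
  exact sum_mem fun j hj => mul_mem (p.coeff j).2 (h j (Finset.mem_range.1 hj))

theorem noether_closure (K : Type*) [Field K] (G : Type*) [Group G] [Finite G]
    (S : Subfield (NoetherBigField K G)) (h : noetherSubfield K G ≤ S) (h1 : nX K 1 ∈ S)
    (x : NoetherBigField K G) : x ∈ S := by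
  have hx : x ∈ IntermediateField.adjoin (noetherSubfield K G) {nX K (1 : G)} := by
    rw [noether_adjoin]; trivial
  have h2 : IntermediateField.adjoin (noetherSubfield K G) {nX K (1 : G)} ≤
      S.toIntermediateField (fun a => h a.2) := by
    rw [IntermediateField.adjoin_le_iff]
    intro y hy
    rw [Set.mem_singleton_iff] at hy
    subst hy
    exact h1
  exact h2 hx

section maps
variable (K : Type*) [Field K] (C : Type*) [Group C] [Fintype C] (G : Type*)

def yy {G : Type*} (g : G) : NoetherBigField K (C × G) := ∑ c : C, nX K (c, g)

def phiPoly : MvPolynomial G K →ₐ[K] MvPolynomial (C × G) K :=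
  MvPolynomial.aeval fun g => ∑ c : C, MvPolynomial.X (c, g)

theorem phiPoly_injective : Function.Injective (phiPoly K C G) := by
  classical
  let r : MvPolynomial (C × G) K →ₐ[K] MvPolynomial G K :=
    MvPolynomial.aeval fun p => if p.1 = 1 then MvPolynomial.X p.2 else 0
  have : r.comp (phiPoly K C G) = AlgHom.id K _ := by
    ext g
    simp [r, phiPoly]
  intro a b hab
  have h2 := congrArg r hab
  have h3 := DFunLike.congr_fun this
  simp only [AlgHom.comp_apply, AlgHom.id_apply] at h3
  rwa [h3, h3] at h2

def phi : NoetherBigField K G →ₐ[K] NoetherBigField K (C × G) :=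
  IsFractionRing.liftAlgHom
    (g := (Algebra.algHom K (MvPolynomial (C × G) K) (NoetherBigField K (C × G))).comp
      (phiPoly K C G))
    ((IsFractionRing.injective (MvPolynomial (C × G) K) _).comp (phiPoly_injective K C G))

theorem phi_nX (g : G) : phi K C G (nX K g) = yy K C g := by
  simp only [phi, nX, IsFractionRing.liftAlgHom_apply, IsFractionRing.lift_algebraMap]
  simp [phiPoly, yy, nX]
  rfl

end maps

section maps2
variable (K : Type*) [Field K] (C : Type*) [Group C] [Fintype C] (G : Type*) [Group G]

theorem aut_yy (a : C) (b g : G) :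
    noetherAut K (C × G) (a, b) (yy K C g) = yy K C (b * g) := by
  simp only [yy, map_sum, noetherAut_nX, Prod.mk_mul_mk]
  exact Fintype.sum_equiv (Equiv.mulLeft a) _ _ fun _ => rfl

theorem aut_phi (a : C) (b : G) (x : NoetherBigField K G) :
    noetherAut K (C × G) (a, b) (phi K C G x) = phi K C G (noetherAut K G b x) := by
  have : ((noetherAut K (C × G) (a, b)).toAlgHom.comp (phi K C G)) =
      (phi K C G).comp (noetherAut K G b).toAlgHom := by
    apply big_hom_ext
    intro i
    simp [phi_nX, aut_yy, noetherAut_nX]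
  exact DFunLike.congr_fun this x

variable {C G} [Fintype G] (χ : C →* K)

def zz (j i : ℕ) : NoetherBigField K (C × G) :=
  ∑ g : G, yy K C g ^ i * ∑ c : C, algebraMap K _ (χ c) ^ j * nX K (c, g)

theorem aut_zz (j i : ℕ) (a : C) (b : G) :
    noetherAut K (C × G) (a, b) (zz K χ j i) = algebraMap K _ (χ a⁻¹) ^ j * zz K χ j i := by
  simp only [zz, map_sum, map_mul, map_pow, aut_yy, noetherAut_nX, AlgEquiv.commutes,
    Prod.mk_mul_mk, Finset.mul_sum]
  refine Fintype.sum_equiv (Equiv.mulLeft b) _ _ fun g => ?_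
  refine Fintype.sum_equiv (Equiv.mulLeft a) _ _ fun c => ?_
  simp only [Equiv.coe_mulLeft]
  have : χ c = χ a⁻¹ * χ (a * c) := by rw [← map_mul, inv_mul_cancel_left]
  rw [this, map_mul]
  ring

theorem zz_ne : zz K χ 1 0 ≠ (0 : NoetherBigField K (C × G)) := by
  classical
  intro h
  let W : MvPolynomial (C × G) K := ∑ g : G, ∑ c : C, MvPolynomial.C (χ c) * MvPolynomial.X (c, g)
  have hW : algebraMap _ (NoetherBigField K (C × G)) W = 0 := by
    rw [← h]
    simp only [W, zz, map_sum, map_mul, pow_zero, one_mul, pow_one]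
    rfl
  have hW0 : W = 0 := by
    apply IsFractionRing.injective (MvPolynomial (C × G) K) (NoetherBigField K (C × G))
    rw [hW, map_zero]
  have h1 := congrArg (MvPolynomial.eval (Pi.single ((1 : C), (1 : G)) (1 : K))) hW0
  simp only [W, map_sum, map_mul, MvPolynomial.eval_C, MvPolynomial.eval_X, map_zero] at h1
  rw [Finset.sum_eq_single 1, Finset.sum_eq_single 1] at h1
  · simp at h1
  · intro c _ hc
    rw [Pi.single_eq_of_ne (by simpa using hc), mul_zero]
  · simp
  · intro g _ hg
    refine Finset.sum_eq_zero fun c _ => ?_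
    rw [Pi.single_eq_of_ne (by simp [hg]), mul_zero]
  · simp
end maps2

theorem finrank_adjoin_le {S E : Type*} [Field S] [Field E] [Algebra S E] (x : E)
    (p : Polynomial S) (hp : p.Monic) (hx : Polynomial.aeval x p = 0) :
    FiniteDimensional S (IntermediateField.adjoin S {x}) ∧
    Module.finrank S (IntermediateField.adjoin S {x}) ≤ p.natDegree := by
  have hi : IsIntegral S x := ⟨p, hp, hx⟩
  refine ⟨IntermediateField.adjoin.finiteDimensional hi, ?_⟩
  rw [IntermediateField.adjoin.finrank hi]
  exact Polynomial.natDegree_le_natDegree (minpoly.min S x hp hx)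

theorem noether_step (K : Type*) [Field K] (G : Type*) [Group G] [Finite G]
    (C : Type*) [Group C] [Finite C] [Nontrivial C] (χ : C →* K) (hχ : Function.Injective χ)
    (hG : IsRationalExtension K (NoetherField K G)) :
    IsRationalExtension K (NoetherField K (C × G)) := by
  have := Fintype.ofFinite C
  have := Fintype.ofFinite G
  obtain ⟨t, ht⟩ := (rational_iff_gen K G).1 hG
  have he : 2 ≤ Nat.card C := Finite.one_lt_card
  have hn : 0 < Nat.card G := Nat.card_pos
  have htm : ∀ i, t i ∈ noetherIF K G := fun i => by
    rw [← ht]; exact IntermediateField.subset_adjoin _ _ ⟨i, rfl⟩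
  let w : NoetherBigField K (C × G) := zz K χ 1 0
  have hw : w ≠ 0 := zz_ne K χ
  let u : Fin (Nat.card C) × Fin (Nat.card G) → NoetherBigField K (C × G) := fun p =>
    if p.1.1 = 0 then phi K C G (t p.2) else
      if p.1.1 = 1 ∧ p.2.1 = 0 then w ^ Nat.card C else zz K χ p.1.1 p.2.1 / w ^ p.1.1
  have hcard : Nat.card (C × G) = Nat.card (Fin (Nat.card C) × Fin (Nat.card G)) := by
    simp [Nat.card_prod]
  rw [rational_iff_gen, hcard]
  refine ⟨u ∘ (Finite.equivFin _).symm, ?_⟩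
  rw [EquivLike.range_comp]
  set S := IntermediateField.adjoin K (Set.range u) with hS
  have hle : S ≤ noetherIF K (C × G) := by
    rw [hS, IntermediateField.adjoin_le_iff]
    rintro _ ⟨p, rfl⟩ ⟨a, b⟩
    have hχa : algebraMap K (NoetherBigField K (C × G)) (χ a⁻¹) ≠ 0 := by
      rw [map_ne_zero]
      intro h0
      have : χ a⁻¹ * χ a = 1 := by rw [← map_mul, inv_mul_cancel, map_one]
      rw [h0, zero_mul] at this
      exact zero_ne_one this
    simp only [u]
    split_ifs with h1 h2
    · rw [aut_phi]
      exact congrArg _ (htm p.2 b)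
    · rw [map_pow, aut_zz, mul_pow, pow_one, ← map_pow, ← map_pow, pow_card_eq_one', map_one,
        map_one, one_mul]
    · rw [map_div₀, map_pow, aut_zz, aut_zz, pow_one, mul_pow]
      exact mul_div_mul_left _ _ (pow_ne_zero _ hχa)
  have huS : ∀ p, u p ∈ S := fun p => IntermediateField.subset_adjoin _ _ ⟨p, rfl⟩
  have hphi : ∀ x ∈ noetherIF K G, phi K C G x ∈ S := by
    have : noetherIF K G ≤ S.comap (phi K C G) := by
      rw [← ht, IntermediateField.adjoin_le_iff]
      rintro _ ⟨i, rfl⟩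
      have := huS (⟨0, by omega⟩, i)
      change phi K C G (t i) ∈ S
      simpa [u] using this
    exact this
  have hwS : w ^ Nat.card C ∈ S := by
    have := huS (⟨1, by omega⟩, ⟨0, hn⟩)
    simpa [u] using this
  -- the generated field is everything
  have htop : IntermediateField.adjoin S {w} ⊔ IntermediateField.adjoin S {phi K C G (nX K 1)}
      = ⊤ := by
    set T := IntermediateField.adjoin S {w} ⊔ IntermediateField.adjoin S {phi K C G (nX K 1)}
      with hT
    have hwT : w ∈ T := (le_sup_left : _ ≤ T) (IntermediateField.mem_adjoin_simple_self _ _)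
    have hST : ∀ x ∈ S, x ∈ T := fun x hx => T.algebraMap_mem (⟨x, hx⟩ : S)
    have hphiT : ∀ x, phi K C G x ∈ T := by
      intro x
      refine noether_closure K G (T.toSubfield.comap (phi K C G).toRingHom) ?_ ?_ x
      · intro y hy
        exact hST _ (hphi y hy)
      · exact (le_sup_right : _ ≤ T) (IntermediateField.mem_adjoin_simple_self _ _)
    have hyT : ∀ g : G, yy K C g ∈ T := fun g => by
      rw [← phi_nX]; exact hphiT _
    have hzT : ∀ j < Nat.card C, ∀ i < Nat.card G, zz K χ j i ∈ T := by
      intro j hj i hi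
      by_cases hj0 : j = 0
      · subst hj0
        refine sum_mem fun g _ => mul_mem (pow_mem (hyT g) i) ?_
        have : ∑ c : C, algebraMap K (NoetherBigField K (C × G)) (χ c) ^ 0 * nX K (c, g)
            = yy K C g := by simp [yy]
        rw [this]
        exact hyT g
      · by_cases h1 : j = 1 ∧ i = 0
        · obtain ⟨rfl, rfl⟩ := h1
          exact hwT
        · have h2 := hST _ (huS (⟨j, hj⟩, ⟨i, hi⟩))
          simp only [u, if_neg hj0, if_neg h1] at h2
          have h3 := mul_mem h2 (pow_mem hwT j)
          rwa [div_mul_cancel₀ _ (pow_ne_zero _ hw)] at h3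
    have hKT : ∀ a : K, algebraMap K (NoetherBigField K (C × G)) a ∈ T := fun a =>
      hST _ (S.algebraMap_mem a)
    have hinjy : Function.Injective (fun g : G => (yy K C g : NoetherBigField K (C × G))) := by
      intro a b hab
      simp only [← phi_nX] at hab
      exact nX_injective K G ((phi K C G).injective hab)
    have hX1 : ∀ j < Nat.card C, ∀ g : G,
        ∑ c : C, algebraMap K (NoetherBigField K (C × G)) (χ c) ^ j * nX K (c, g) ∈ T := by
      intro j hj
      refine vand T.toSubfield (fun g : G => yy K C g) (fun g => ∑ c : C,
        algebraMap K (NoetherBigField K (C × G)) (χ c) ^ j * nX K (c, g)) hinjy hyT ?_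
      intro i hi
      rw [← Nat.card_eq_fintype_card] at hi
      exact hzT j hj i hi
    have hX2 : ∀ g : G, ∀ c : C, nX K (c, g) ∈ T := by
      intro g
      refine vand T.toSubfield (fun c : C => algebraMap K (NoetherBigField K (C × G)) (χ c))
        (fun c => nX K (c, g)) ((algebraMap K _).injective.comp hχ) (fun c => hKT _) ?_
      intro j hj
      rw [← Nat.card_eq_fintype_card] at hj
      exact hX1 j hj g
    have hall : (⊤ : IntermediateField K (NoetherBigField K (C × G))) ≤
        T.toSubfield.toIntermediateField hKT := by
      rw [← adjoin_nX, IntermediateField.adjoin_le_iff]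
      rintro _ ⟨⟨c, g⟩, rfl⟩
      exact hX2 g c
    rw [eq_top_iff]
    intro x _
    exact hall (trivial : x ∈ (⊤ : IntermediateField K (NoetherBigField K (C × G))))
  -- degree bounds
  obtain ⟨f1, d1⟩ := finrank_adjoin_le (S := S) w
    (Polynomial.X ^ Nat.card C - Polynomial.C (⟨w ^ Nat.card C, hwS⟩ : S))
    (Polynomial.monic_X_pow_sub_C _ (by omega)) (by
      rw [map_sub, map_pow, Polynomial.aeval_X, Polynomial.aeval_C]
      exact sub_self _)
  rw [Polynomial.natDegree_X_pow_sub_C] at d1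
  have hfd := noether_findim K G
  let ψ : noetherSubfield K G →+* S :=
    ((phi K C G).toRingHom.comp (noetherSubfield K G).subtype).codRestrict S
      (fun x => hphi _ x.2)
  have hint : IsIntegral (noetherSubfield K G) (nX K (1 : G)) := Algebra.IsIntegral.isIntegral _
  obtain ⟨f2, d2⟩ := finrank_adjoin_le (S := S) (phi K C G (nX K 1))
    ((minpoly (noetherSubfield K G) (nX K (1 : G))).map ψ)
    ((minpoly.monic hint).map _) (by
      rw [Polynomial.aeval_def, Polynomial.eval₂_map]
      have h0 := congrArg (phi K C G) (minpoly.aeval (noetherSubfield K G) (nX K (1 : G)))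
      rw [Polynomial.aeval_def, map_zero] at h0
      rw [← h0]
      exact (Polynomial.hom_eval₂ _ _ (phi K C G).toRingHom _).symm)
  have d2' : Module.finrank S (IntermediateField.adjoin S {phi K C G (nX K 1)}) ≤ Nat.card G := by
    refine d2.trans (Polynomial.natDegree_map_le.trans ?_)
    rw [← noether_finrank K G]
    exact minpoly.natDegree_le _
  have hfin : FiniteDimensional S (NoetherBigField K (C × G)) := by
    have : FiniteDimensional S (↥(IntermediateField.adjoin S {w} ⊔
      IntermediateField.adjoin S {phi K C G (nX K 1)})) := inferInstance
    rw [htop] at this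
    exact Module.Finite.equiv
      (IntermediateField.topEquiv (F := S) (E := NoetherBigField K (C × G))).toLinearEquiv
  have hfr : Module.finrank S (NoetherBigField K (C × G)) ≤ Nat.card (C × G) := by
    have h1 := IntermediateField.finrank_sup_le (IntermediateField.adjoin S {w})
      (IntermediateField.adjoin S {phi K C G (nX K 1)})
    rw [htop, IntermediateField.finrank_top'] at h1
    rw [Nat.card_prod]
    exact h1.trans (Nat.mul_le_mul d1 d2')
  refine IntermediateField.eq_of_le_of_finrank_le' hle ?_
  rw [noetherIF_finrank]
  exact hfr

theorem noether_transport (K : Type*) [Field K] {G G' : Type*} [Group G] [Group G'] (σ : G ≃* G')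
    (hG : IsRationalExtension K (NoetherField K G)) :
    IsRationalExtension K (NoetherField K G') := by
  let f : NoetherBigField K G ≃ₐ[K] NoetherBigField K G' :=
    IsFractionRing.algEquivOfAlgEquiv (MvPolynomial.renameEquiv K σ.toEquiv)
  have hfX : ∀ g, f (nX K g) = nX K (σ g) := fun g => by simp [f, nX]
  have hf : ∀ h x, f (noetherAut K G h x) = noetherAut K G' (σ h) (f x) := by
    intro h x
    have : f.toAlgHom.comp (noetherAut K G h).toAlgHom =
        (noetherAut K G' (σ h)).toAlgHom.comp f.toAlgHom := by
      apply big_hom_ext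
      intro i
      simp [hfX, noetherAut_nX]
    exact DFunLike.congr_fun this x
  have hmap : (noetherIF K G).map f.toAlgHom = noetherIF K G' := by
    ext x
    rw [IntermediateField.mem_map]
    constructor
    · rintro ⟨y, hy, rfl⟩ h
      have := hf (σ.symm h) y
      rw [hy, MulEquiv.apply_symm_apply] at this
      exact this.symm
    · intro hx
      refine ⟨f.symm x, fun h => ?_, f.apply_symm_apply x⟩
      apply f.injective
      rw [hf, AlgEquiv.apply_symm_apply]
      exact hx _
  obtain ⟨n, ⟨e⟩⟩ := hG
  refine ⟨n, ⟨(noetherFieldEquiv K G').trans (((IntermediateField.equivOfEq hmap).symm.trans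
    (IntermediateField.equivMap _ f.toAlgHom).symm).trans ((noetherFieldEquiv K G).symm.trans e))⟩⟩

theorem noether_step' (K : Type*) [Field K] (G : Type*) [Group G] [Finite G]
    (C : Type*) [Group C] [Finite C] (χ : C →* K) (hχ : Function.Injective χ)
    (hG : IsRationalExtension K (NoetherField K G)) :
    IsRationalExtension K (NoetherField K (C × G)) := by
  rcases subsingleton_or_nontrivial C with h | h
  · have := uniqueOfSubsingleton (1 : C)
    exact noether_transport K (MulEquiv.uniqueProd (M := G) (N := C)).symm hG
  · exact noether_step K G C χ hχ hG

theorem noether_fin (K : Type*) [Field K] (r : ℕ) : ∀ (A : Fin r → Type) [∀ i, Group (A i)]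
    [∀ i, Finite (A i)] (χ : ∀ i, A i →* K) (_ : ∀ i, Function.Injective (χ i))
    (G : Type*) [Group G] [Finite G] (_ : IsRationalExtension K (NoetherField K G)),
    IsRationalExtension K (NoetherField K ((∀ i, A i) × G)) := by
  induction r with
  | zero =>
    intro A _ _ χ hχ G _ _ hG
    exact noether_transport K (MulEquiv.uniqueProd (M := G) (N := ∀ i, A i)).symm hG
  | succ r ih =>
    intro A _ _ χ hχ G _ _ hG
    have h1 := ih (fun i => A i.succ) (fun i => χ i.succ) (fun i => hχ i.succ) G hG
    have h2 := noether_step' K _ (A 0) (χ 0) (hχ 0) h1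
    have σ : (A 0 × (∀ i : Fin r, A i.succ)) ≃* ∀ i, A i :=
      { Fin.consEquiv A with
        map_mul' := by
          intro a b
          ext i
          refine Fin.cases ?_ (fun i => ?_) i <;> simp [Fin.consEquiv] }
    exact noether_transport K (MulEquiv.prodAssoc.symm.trans
      (MulEquiv.prodCongr σ (MulEquiv.refl G))) h2

/-- If `H` is a finite abelian group of exponent `e`, `K` contains a primitive `e`-th root of
unity, and `K(G)` is rational over `K`, then `K(H × G)` is rational over `K`. -/
theorem noether_rational_of_direct_product_abelian
    (K : Type*) [Field K] (G : Type*) [Group G] [Finite G]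
    (H : Type*) [CommGroup H] [Finite H] (e : ℕ)
    (he : Monoid.exponent H = e) (ζ : K) (hζ : IsPrimitiveRoot ζ e)
    (hG : IsRationalExtension K (NoetherField K G)) :
    IsRationalExtension K (NoetherField K (H × G)) := by
  obtain ⟨ι, _, n, hn, ⟨τ⟩⟩ := CommGroup.equiv_prod_multiplicative_zmod_of_finite H
  let s := Fintype.equivFin ι
  let A : Fin (Fintype.card ι) → Type := fun i => Multiplicative (ZMod (n (s.symm i)))
  have hnz : ∀ i, NeZero (n i) := fun i => ⟨by have := hn i; omega⟩
  have hfinA : ∀ i, Finite (A i) := fun i =>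
    inferInstanceAs (Finite (Multiplicative (ZMod (n (s.symm i)))))
  let ρ : (∀ i, Multiplicative (ZMod (n i))) ≃* ∀ i, A i :=
    { (Equiv.piCongrLeft' (fun i => Multiplicative (ZMod (n i))) s) with
      map_mul' := fun a b => rfl }
  have hdvd : ∀ i, n i ∣ e := by
    intro i
    have h1 : Monoid.exponent (Multiplicative (ZMod (n i))) ∣
        Monoid.exponent (∀ i, Multiplicative (ZMod (n i))) := by
      classical
      exact Monoid.exponent_dvd_of_monoidHom
        (MonoidHom.mulSingle (fun i => Multiplicative (ZMod (n i))) i) (fun a b hab => by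
          have := congrFun hab i
          simpa using this)
    rw [← Monoid.exponent_eq_of_mulEquiv τ, he] at h1
    rwa [IsCyclic.exponent_eq_card, Nat.card_eq_fintype_card, Fintype.card_multiplicative,
      ZMod.card] at h1
  have hchar : ∀ i, ∃ χ : Multiplicative (ZMod (n i)) →* K, Function.Injective χ := by
    intro i
    have hepos : 0 < e := he ▸ Monoid.exponent_pos.2 Monoid.ExponentExists.of_finite
    obtain ⟨q, hq⟩ := hdvd i
    have hp := hζ.pow hepos (by rw [hq, mul_comm] : e = q * n i)
    refine ⟨(AddChar.zmodChar (n i) hp.pow_eq_one).toMonoidHom, ?_⟩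
    intro a b hab
    have hab' : (ζ ^ q) ^ (ZMod.val a.toAdd) = (ζ ^ q) ^ (ZMod.val b.toAdd) := hab
    have := hp.pow_inj (ZMod.val_lt _) (ZMod.val_lt _) hab'
    exact Multiplicative.toAdd.injective (ZMod.val_injective _ this)
  choose χ hχ using hchar
  have h1 := noether_fin K _ A (fun i => χ (s.symm i)) (fun i => hχ (s.symm i)) G hG
  exact noether_transport K (MulEquiv.prodCongr (τ.trans ρ).symm (MulEquiv.refl G)) h1

end
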